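/- Let K be a field of characteristic 2 and V a 2-dimensional K-vector space with basis {x_1, y_1} (m = 1), and consider the even-degree subcomplex D^0V: 0 → K → D_2V → D_4V → ... of the divided power algebra complex (DV, ∂), where the differential is multiplication by ω = x_1y_1. Then D^0V is exact: ∂_0 is injective, and for every even k ≥ 2 the kernel of ∂_k: D_kV → D_{k+2}V equals the image of ∂_{k−2}: D_{k−2}V → D_kV; moreover ker ∂_k is spanned by the monomials x_1^{(a)}y_1^{(b)} with a + b = k and both a and b odd. -/

import Mathlib

noncomputable section

open Finsupp TensorProduct

/-- The underlying space of the divided power algebra `DV` of a vector space `V` with basis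
indexed by `ι`: the free `K`-module on the set of multi-indices, where a multi-index
`a : ι →₀ ℕ` corresponds to the basis monomial `∏ᵢ vᵢ^{(a i)}`. -/
abbrev DPA (K ι : Type) [Field K] := (ι →₀ ℕ) →₀ K

/-- Total degree of a multi-index. -/
def deg {ι : Type} (a : ι →₀ ℕ) : ℕ := a.sum fun _ e => e

/-- The degree-`k` homogeneous component `D_k V` of the divided power algebra. -/
def Dsub (K ι : Type) [Field K] (k : ℕ) : Submodule K (DPA K ι) :=
  Submodule.span K {f | ∃ a : ι →₀ ℕ, deg a = k ∧ f = Finsupp.single a (1 : K)}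

/-- The structure constant of the divided power algebra:
`(∏ᵢ vᵢ^{(a i)}) ⬝ (∏ᵢ vᵢ^{(b i)}) = (∏ᵢ C(a i + b i, a i)) • ∏ᵢ vᵢ^{(a i + b i)}`. -/
def dpCoef {ι : Type} (a b : ι →₀ ℕ) : ℕ :=
  (a + b).prod fun i _ => Nat.choose (a i + b i) (a i)

/-- Multiplication of the divided power algebra, as a bilinear map. -/
def dpMul (K ι : Type) [Field K] : DPA K ι →ₗ[K] DPA K ι →ₗ[K] DPA K ι :=
  Finsupp.lsum K fun a => LinearMap.toSpanSingleton K _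
    (Finsupp.lsum K fun b => LinearMap.toSpanSingleton K _
      ((dpCoef a b : K) • Finsupp.single (a + b) (1 : K)))

/-- Divided power `w^{(n)} ∈ D_n V` of a vector `w = ∑ᵢ wᵢ vᵢ ∈ V`; it is determined by the
rules `(u+v)^{(a)} = ∑ u^{(i)} v^{(a-i)}` and `(t u)^{(a)} = tᵃ u^{(a)}`. -/
def dpow {K ι : Type} [Field K] [Fintype ι] [DecidableEq ι] (w : ι → K) (n : ℕ) : DPA K ι :=
  ∑ c ∈ Finset.univ.finsuppAntidiag n, Finsupp.single c (c.prod fun i e => w i ^ e)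

/-- The image `∏ᵢ (g vᵢ)^{(a i)}` of the basis monomial `∏ᵢ vᵢ^{(a i)}` under the algebra
endomorphism of `DV` induced by the matrix `g`. -/
def actMon {K ι : Type} [Field K] [Fintype ι] [DecidableEq ι]
    (g : Matrix ι ι K) (a : ι →₀ ℕ) : DPA K ι :=
  (a.support.toList.map fun i => dpow (fun j => g j i) (a i)).foldr
    (fun p q => dpMul K ι p q) (Finsupp.single 0 1)

/-- The algebra endomorphism of `DV` induced by the matrix `g` acting on `V` in the given
basis (for `g` invertible this is the induced algebra automorphism of `DV`). -/
def act {K ι : Type} [Field K] [Fintype ι] [DecidableEq ι] (g : Matrix ι ι K) :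
    DPA K ι →ₗ[K] DPA K ι :=
  Finsupp.lsum K fun a => LinearMap.toSpanSingleton K _ (actMon g a)

/-- The entrywise square of a matrix (giving the Frobenius twist of a representation
in characteristic 2). -/
def matSq {K ι : Type} [Field K] (g : Matrix ι ι K) : Matrix ι ι K :=
  fun i j => g i j * g i j

/-! Symplectic setting: `V` has dimension `2m` and symplectic basis `x_1,y_1,…,x_m,y_m`
indexed by `Fin m × Bool`, with `x_i = (i, false)` and `y_i = (i, true)`. -/

/-- The multi-index of the monomial `x_i y_i`. -/
def xyIdx (m : ℕ) (i : Fin m) : (Fin m × Bool) →₀ ℕ :=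
  Finsupp.single (i, false) 1 + Finsupp.single (i, true) 1

/-- The element `ω = x_1 y_1 + ⋯ + x_m y_m ∈ D_2 V`. -/
def omegaDP (K : Type) [Field K] (m : ℕ) : DPA K (Fin m × Bool) :=
  ∑ i : Fin m, Finsupp.single (xyIdx m i) (1 : K)

/-- The differential `∂` of the complex `DV`: multiplication by `ω`.  It restricts to
`∂_k : D_k V → D_{k+2} V`. -/
def del (K : Type) [Field K] (m : ℕ) :
    DPA K (Fin m × Bool) →ₗ[K] DPA K (Fin m × Bool) :=
  dpMul K (Fin m × Bool) (omegaDP K m)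

/-- The matrix of the non-degenerate alternating bilinear form `f` with `f(x_i, y_j) = δᵢⱼ`,
`f(x_i, x_j) = f(y_i, y_j) = 0`. -/
def Jmat (K : Type) [Field K] (m : ℕ) : Matrix (Fin m × Bool) (Fin m × Bool) K :=
  fun p q => if p.1 = q.1 ∧ p.2 ≠ q.2 then 1 else 0

/-- The condition that the matrix `g` belongs to the symplectic group `Sp(V)`:
`g` preserves the form `f`, i.e. `f(gu, gv) = f(u, v)` for all `u, v ∈ V`. -/
def IsSymplectic {K : Type} [Field K] {m : ℕ}
    (g : Matrix (Fin m × Bool) (Fin m × Bool) K) : Prop :=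
  g.transpose * Jmat K m * g = Jmat K m

/-- The cocycles in degree `k`: `ker ∂_k = ker ∂ ∩ D_k V`. -/
def Zmod (K : Type) [Field K] (m k : ℕ) : Submodule K (DPA K (Fin m × Bool)) :=
  LinearMap.ker (del K m) ⊓ Dsub K (Fin m × Bool) k

/-- The coboundaries in degree `k`: `Im ∂_{k-2} = ∂(D_{k-2} V)`.  (For `k = 0, 1`
truncated subtraction gives `∂(D_0 V) ⊆ D_2 V`, which meets `D_k V` only in `0`,
so no harm is done.) -/
def Bful (K : Type) [Field K] (m k : ℕ) : Submodule K (DPA K (Fin m × Bool)) :=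
  Submodule.map (del K m) (Dsub K (Fin m × Bool) (k - 2))

/-- The cohomology `H^k(DV) = ker ∂_k / Im ∂_{k-2}` of the complex `DV`, realized as the
image of `ker ∂_k` in `DV / Im ∂_{k-2}`. -/
abbrev Hcoh (K : Type) [Field K] (m k : ℕ) :=
  ↥(Submodule.map (Bful K m k).mkQ (Zmod K m k))

/-- The canonical projection `ker ∂_k → H^k(DV)`, sending a cocycle `z` to its
cohomology class `z + Im ∂_{k-2}`. -/
def toH (K : Type) [Field K] (m k : ℕ) : ↥(Zmod K m k) →ₗ[K] Hcoh K m k :=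
  LinearMap.codRestrict _ ((Bful K m k).mkQ.comp (Zmod K m k).subtype)
    (fun z => Submodule.mem_map_of_mem z.2)


lemma xc_eta (c : (Fin 1 × Bool) →₀ ℕ) :
    c = Finsupp.single ((0 : Fin 1), false) (c (0, false))
      + Finsupp.single ((0 : Fin 1), true) (c (0, true)) := by
  ext ⟨i, b⟩
  have hi : i = 0 := Subsingleton.elim _ _
  subst hi
  cases b <;> simp [Finsupp.single_apply]

lemma deg_eq_fin (c : (Fin 1 × Bool) →₀ ℕ) : deg c = c (0, false) + c (0, true) := by
  unfold deg
  rw [Finsupp.sum_fintype _ _ (fun _ => rfl), Fintype.sum_prod_type]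
  simp [add_comm]

lemma dpCoef_fin (c : (Fin 1 × Bool) →₀ ℕ) :
    dpCoef (xyIdx 1 0) c = (c (0, false) + 1) * (c (0, true) + 1) := by
  unfold dpCoef
  have hs : (xyIdx 1 0 + c).support = Finset.univ := by
    ext ⟨i, b⟩
    have hi : i = 0 := Subsingleton.elim _ _
    subst hi
    cases b <;> simp [xyIdx]
  rw [Finsupp.prod, hs, Fintype.prod_prod_type]
  simp [xyIdx, Finsupp.single_apply]
  ring

lemma del_single (K : Type) [Field K] (c : (Fin 1 × Bool) →₀ ℕ) (r : K) :
    del K 1 (Finsupp.single c r) = Finsupp.single (xyIdx 1 0 + c)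
      (r * (((c (0, false) + 1) * (c (0, true) + 1) : ℕ) : K)) := by
  simp only [del, omegaDP, dpMul, Finset.univ_unique, Fin.default_eq_zero, Finset.sum_singleton,
    Finsupp.lsum_single, LinearMap.toSpanSingleton_apply, one_smul, dpCoef_fin,
    Finsupp.smul_single, smul_eq_mul, mul_one]

lemma del_coeff (K : Type) [Field K] (f : DPA K (Fin 1 × Bool)) (c : (Fin 1 × Bool) →₀ ℕ) :
    del K 1 f (xyIdx 1 0 + c) = f c * (((c (0, false) + 1) * (c (0, true) + 1) : ℕ) : K) := by
  classical
  induction f using Finsupp.induction_linear with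
  | zero => simp
  | add f g hf hg => rw [(del K 1).map_add, Finsupp.add_apply, hf, hg, Finsupp.add_apply, add_mul (f c)]
  | single d r =>
    rw [del_single]
    by_cases h : d = c
    · subst h; simp
    · rw [Finsupp.single_eq_of_ne (by simpa using Ne.symm h),
        Finsupp.single_eq_of_ne (Ne.symm h), zero_mul]

lemma Dsub_eq (K : Type) [Field K] (k : ℕ) :
    Dsub K (Fin 1 × Bool) k = Finsupp.supported K K {c | deg c = k} := by
  rw [Finsupp.supported_eq_span_single]
  unfold Dsub
  congr 1
  ext f
  simp [eq_comm]

lemma coef_zero (K : Type) [Field K] [CharP K 2] (a b : ℕ) :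
    (((a + 1) * (b + 1) : ℕ) : K) = 0 ↔ Odd a ∨ Odd b := by
  rw [CharP.cast_eq_zero_iff K 2, Nat.prime_two.dvd_mul, ← even_iff_two_dvd, ← even_iff_two_dvd,
    Nat.even_add_one, Nat.even_add_one, Nat.not_even_iff_odd, Nat.not_even_iff_odd]

lemma ker_coef (K : Type) [Field K] [CharP K 2] (f : DPA K (Fin 1 × Bool))
    (hf : del K 1 f = 0) (c : (Fin 1 × Bool) →₀ ℕ) (hc : f c ≠ 0) :
    Odd (c (0, false)) ∨ Odd (c (0, true)) := by
  have h := del_coeff K f c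
  rw [hf] at h
  rw [← coef_zero K]
  simpa [hc] using h.symm

/-- For `m = 1`, the even-degree subcomplex
`D^0V : 0 → K → D_2V → D_4V → ⋯` is exact: `∂_0` is injective, and for every even `k ≥ 2`
one has `ker ∂_k = Im ∂_{k-2}`; moreover `ker ∂_k` is spanned by the monomials
`x_1^{(a)} y_1^{(b)}` with `a + b = k` and both `a` and `b` odd. -/
theorem statement_15 (K : Type) [Field K] [CharP K 2] :
    (LinearMap.ker (del K 1) ⊓ Dsub K (Fin 1 × Bool) 0 = ⊥) ∧
    ∀ k : ℕ, Even k → 2 ≤ k →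
      LinearMap.ker (del K 1) ⊓ Dsub K (Fin 1 × Bool) k
          = Submodule.map (del K 1) (Dsub K (Fin 1 × Bool) (k - 2)) ∧
      LinearMap.ker (del K 1) ⊓ Dsub K (Fin 1 × Bool) k
          = Submodule.span K {f | ∃ a b : ℕ, a + b = k ∧ Odd a ∧ Odd b ∧
              f = Finsupp.single (Finsupp.single ((0 : Fin 1), false) a
                  + Finsupp.single ((0 : Fin 1), true) b) (1 : K)} := by
  have hspan : ∀ k, Submodule.span K {f | ∃ a b : ℕ, a + b = k ∧ Odd a ∧ Odd b ∧
              f = Finsupp.single (Finsupp.single ((0 : Fin 1), false) a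
                  + Finsupp.single ((0 : Fin 1), true) b) (1 : K)}
      = Finsupp.supported K K {c : (Fin 1 × Bool) →₀ ℕ |
          c (0, false) + c (0, true) = k ∧ Odd (c (0, false)) ∧ Odd (c (0, true))} := by
    intro k
    rw [Finsupp.supported_eq_span_single]
    congr 1
    ext f
    constructor
    · rintro ⟨a, b, h, ha, hb, rfl⟩
      refine ⟨_, ?_, rfl⟩
      simp [Finsupp.single_apply, h, ha, hb]
    · rintro ⟨c, ⟨h, ha, hb⟩, rfl⟩
      exact ⟨_, _, h, ha, hb, by rw [← xc_eta]⟩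
  refine ⟨?_, ?_⟩
  · rw [eq_bot_iff]
    rintro f ⟨hf, hd⟩
    rw [Dsub_eq] at hd
    rw [Submodule.mem_bot]
    ext c
    by_contra hc
    have h1 : deg c = 0 := hd (Finsupp.mem_support_iff.2 hc)
    rw [deg_eq_fin] at h1
    have h2 := ker_coef K f hf c hc
    rcases h2 with ⟨n, hn⟩ | ⟨n, hn⟩ <;> omega
  · intro k hk hk2
    have h1 : LinearMap.ker (del K 1) ⊓ Dsub K (Fin 1 × Bool) k
          ≤ Submodule.span K {f | ∃ a b : ℕ, a + b = k ∧ Odd a ∧ Odd b ∧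
              f = Finsupp.single (Finsupp.single ((0 : Fin 1), false) a
                  + Finsupp.single ((0 : Fin 1), true) b) (1 : K)} := by
      rintro f ⟨hf, hd⟩
      rw [Dsub_eq] at hd
      rw [hspan]
      intro c hc
      have h1 : deg c = k := hd hc
      rw [deg_eq_fin] at h1
      have h2 := ker_coef K f hf c (Finsupp.mem_support_iff.1 hc)
      refine ⟨h1, ?_⟩
      rw [← h1] at hk
      grind
    have h2 : Submodule.span K {f | ∃ a b : ℕ, a + b = k ∧ Odd a ∧ Odd b ∧
              f = Finsupp.single (Finsupp.single ((0 : Fin 1), false) a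
                  + Finsupp.single ((0 : Fin 1), true) b) (1 : K)}
          ≤ Submodule.map (del K 1) (Dsub K (Fin 1 × Bool) (k - 2)) := by
      rw [Submodule.span_le]
      rintro _ ⟨_, _, h, ⟨a, rfl⟩, ⟨b, rfl⟩, rfl⟩
      refine ⟨Finsupp.single (Finsupp.single ((0 : Fin 1), false) (2 * a)
                  + Finsupp.single ((0 : Fin 1), true) (2 * b)) (1 : K), ?_, ?_⟩
      · refine Submodule.subset_span ⟨_, ?_, rfl⟩
        rw [deg_eq_fin]
        simp [Finsupp.single_apply]
        omega
      · rw [del_single]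
        have h20 : (2 : K) = 0 := CharTwo.two_eq_zero
        congr 1
        · rw [xc_eta (xyIdx 1 0 + _)]
          simp [xyIdx, Finsupp.single_apply, add_comm]
        · simp [Finsupp.single_apply, h20]
    have h3 : Submodule.map (del K 1) (Dsub K (Fin 1 × Bool) (k - 2))
          ≤ LinearMap.ker (del K 1) ⊓ Dsub K (Fin 1 × Bool) k := by
      rw [Submodule.map_le_iff_le_comap]
      conv_lhs => unfold Dsub
      rw [Submodule.span_le]
      rintro _ ⟨c, h, rfl⟩
      rw [deg_eq_fin] at h
      refine ⟨?_, ?_⟩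
      · change del K 1 (del K 1 _) = 0
        rw [del_single, del_single, Finsupp.single_eq_zero, mul_assoc, ← Nat.cast_mul, one_mul,
          CharP.cast_eq_zero_iff K 2, Nat.prime_two.dvd_mul, ← even_iff_two_dvd,
          ← even_iff_two_dvd]
        simp only [xyIdx, Finsupp.add_apply, Finsupp.single_apply]
        simp only [Prod.mk.injEq, true_and, if_true, if_false, reduceCtorEq, Nat.even_mul,
          Nat.even_add_one]
        grind
      · rw [del_single, Dsub_eq]
        refine Finsupp.single_mem_supported K _ ?_
        change deg _ = k
        rw [deg_eq_fin]
        simp [xyIdx, Finsupp.single_apply]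
        omega
    exact ⟨le_antisymm (h1.trans h2) h3, le_antisymm h1 (h2.trans h3)⟩
end
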